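/- Fixed-visit-number generating function (Eq. (3.14), K ≥ 1 case): for every real λ with 0 < λ < 1, every integer Z ≥ 1, every integer X, and every integer K ≥ 1, ∑_{N=0}^∞ λ^N P_N(X, K | Z) = (2α²/(1+α²))^{K−1} α^{Z + |X−Z|}, where α = (1 − √(1−λ²))/λ. -/

import Mathlib

open Finset Filter Real

noncomputable section

/-- A walk path of length `N` is `ε : Fin N → Bool`; `true` means a `+1` step,
`false` a `-1` step. `S ε n` is the partial sum `S_n` of the first `n` steps. -/
def S {N : ℕ} (ε : Fin N → Bool) (n : ℕ) : ℤ :=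
  ∑ i ∈ Finset.univ.filter (fun i : Fin N => (i : ℕ) < n), (if ε i then (1 : ℤ) else -1)

/-- `p N X`: probability the simple symmetric random walk is at `X` after `N` steps. -/
def p (N : ℕ) (X : ℤ) : ℝ :=
  ((Finset.univ.filter (fun ε : Fin N → Bool => S ε N = X)).card : ℝ) / 2 ^ N

/-- Number of visits of the path `ε` to site `Z` at times `n ∈ {1, …, N}`. -/
def visits (N : ℕ) (Z : ℤ) (ε : Fin N → Bool) : ℕ :=
  ((Finset.Icc 1 N).filter (fun n => S ε n = Z)).card

/-- `P N X K Z`: joint probability that after `N` steps the walk is at `X`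
and has visited `Z` exactly `K` times. -/
def P (N : ℕ) (X : ℤ) (K : ℕ) (Z : ℤ) : ℝ :=
  ((Finset.univ.filter
      (fun ε : Fin N → Bool => S ε N = X ∧ visits N Z ε = K)).card : ℝ) / 2 ^ N

/-- `Pmarg N K Z`: probability of exactly `K` visits to `Z` in the first `N` steps. -/
def Pmarg (N : ℕ) (K : ℕ) (Z : ℤ) : ℝ :=
  ((Finset.univ.filter (fun ε : Fin N → Bool => visits N Z ε = K)).card : ℝ) / 2 ^ N

/-- Extending a path by one step leaves the earlier partial sums unchanged. -/
lemma S_snoc_of_le {N : ℕ} (ε : Fin N → Bool) (b : Bool) {n : ℕ} (hn : n ≤ N) :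
    S (Fin.snoc ε b : Fin (N + 1) → Bool) n = S ε n := by
  unfold S
  rw [Finset.sum_filter, Finset.sum_filter, Fin.sum_univ_castSucc]
  simp [hn]

lemma S_snoc_succ {N : ℕ} (ε : Fin N → Bool) (b : Bool) :
    S (Fin.snoc ε b : Fin (N + 1) → Bool) (N + 1) = S ε N + if b then 1 else -1 := by
  unfold S
  rw [Finset.sum_filter, Finset.sum_filter, Fin.sum_univ_castSucc]
  simp

lemma visits_snoc {N : ℕ} (Z : ℤ) (ε : Fin N → Bool) (b : Bool) :
    visits (N + 1) Z (Fin.snoc ε b) =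
      visits N Z ε + if S ε N + (if b then 1 else -1) = Z then 1 else 0 := by
  unfold visits
  rw [Finset.card_filter, Finset.card_filter, Finset.sum_Icc_succ_top (by omega), S_snoc_succ]
  congr 1
  refine Finset.sum_congr rfl fun n hn => ?_
  rw [S_snoc_of_le ε b (Finset.mem_Icc.1 hn).2]

lemma card_filter_snoc {N : ℕ} (q : (Fin (N + 1) → Bool) → Prop) [DecidablePred q] :
    (Finset.univ.filter q).card =
      (Finset.univ.filter fun ε : Fin N → Bool => q (Fin.snoc ε true)).card +
      (Finset.univ.filter fun ε : Fin N → Bool => q (Fin.snoc ε false)).card := by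
  simp only [Finset.card_filter]
  rw [← (Fin.snocEquiv fun _ : Fin (N + 1) => Bool).sum_comp, Fintype.sum_prod_type,
    Fintype.sum_bool]
  rfl

lemma P_zero (X Z : ℤ) (K : ℕ) : P 0 X K Z = if X = 0 ∧ K = 0 then 1 else 0 := by
  by_cases h : X = 0 ∧ K = 0
  · simp [P, S, visits, h]
  · rw [if_neg h]
    simp only [P, S, visits]
    simp
    grind

lemma P_succ_of_ne {X Z : ℤ} (h : X ≠ Z) (N K : ℕ) :
    P (N + 1) X K Z = (P N (X - 1) K Z + P N (X + 1) K Z) / 2 := by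
  have h₁ : ∀ ε : Fin N → Bool, (S ε N + 1 = X ∧
      visits N Z ε + (if S ε N + 1 = Z then 1 else 0) = K) ↔
      (S ε N = X - 1 ∧ visits N Z ε = K) := by grind
  have h₂ : ∀ ε : Fin N → Bool, (S ε N + -1 = X ∧
      visits N Z ε + (if S ε N + -1 = Z then 1 else 0) = K) ↔
      (S ε N = X + 1 ∧ visits N Z ε = K) := by grind
  unfold P
  rw [card_filter_snoc]
  simp only [S_snoc_succ, visits_snoc, if_true, Bool.false_eq_true, if_false, h₁, h₂]
  push_cast
  ring

lemma P_succ_self_succ (Z : ℤ) (N K : ℕ) :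
    P (N + 1) Z (K + 1) Z = (P N (Z - 1) K Z + P N (Z + 1) K Z) / 2 := by
  have h₁ : ∀ ε : Fin N → Bool, (S ε N + 1 = Z ∧
      visits N Z ε + (if S ε N + 1 = Z then 1 else 0) = K + 1) ↔
      (S ε N = Z - 1 ∧ visits N Z ε = K) := by grind
  have h₂ : ∀ ε : Fin N → Bool, (S ε N + -1 = Z ∧
      visits N Z ε + (if S ε N + -1 = Z then 1 else 0) = K + 1) ↔
      (S ε N = Z + 1 ∧ visits N Z ε = K) := by grind
  unfold P
  rw [card_filter_snoc]
  simp only [S_snoc_succ, visits_snoc, if_true, Bool.false_eq_true, if_false, h₁, h₂]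
  push_cast
  ring

lemma P_succ_self_zero (Z : ℤ) (N : ℕ) : P (N + 1) Z 0 Z = 0 := by
  have h₁ : ∀ b : ℤ, ∀ ε : Fin N → Bool, (S ε N + b = Z ∧
      visits N Z ε + (if S ε N + b = Z then 1 else 0) = 0) ↔ False := by grind
  unfold P
  rw [card_filter_snoc]
  simp only [S_snoc_succ, visits_snoc, h₁]
  simp

lemma P_nonneg (N : ℕ) (X : ℤ) (K : ℕ) (Z : ℤ) : 0 ≤ P N X K Z := by
  unfold P
  positivity

lemma P_le_one (N : ℕ) (X : ℤ) (K : ℕ) (Z : ℤ) : P N X K Z ≤ 1 := by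
  unfold P
  rw [div_le_one (by positivity)]
  refine (Nat.cast_le.2 (Finset.card_le_univ _)).trans ?_
  simp

lemma summable_pow_mul_P {l : ℝ} (hl0 : 0 < l) (hl1 : l < 1) (X : ℤ) (K : ℕ) (Z : ℤ) :
    Summable fun N : ℕ => l ^ N * P N X K Z :=
  Summable.of_nonneg_of_le (fun N => mul_nonneg (by positivity) (P_nonneg N X K Z))
    (fun N => mul_le_of_le_one_right (by positivity) (P_le_one N X K Z))
    (summable_geometric_of_lt_one hl0.le hl1)

/-- The generating function `∑ N, l ^ N * P N X K Z`. -/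
def visitGF (l : ℝ) (K : ℕ) (Z X : ℤ) : ℝ :=
  ∑' N : ℕ, l ^ N * P N X K Z

lemma abs_visitGF_le {l : ℝ} (hl0 : 0 < l) (hl1 : l < 1) (K : ℕ) (Z X : ℤ) :
    |visitGF l K Z X| ≤ (1 - l)⁻¹ := by
  unfold visitGF
  rw [abs_of_nonneg (tsum_nonneg fun N => mul_nonneg (by positivity) (P_nonneg N X K Z)),
    ← tsum_geometric_of_lt_one hl0.le hl1]
  exact (summable_pow_mul_P hl0 hl1 X K Z).tsum_le_tsum
    (fun N => mul_le_of_le_one_right (by positivity) (P_le_one N X K Z))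
    (summable_geometric_of_lt_one hl0.le hl1)

lemma visitGF_eq_of_succ {l : ℝ} (hl0 : 0 < l) (hl1 : l < 1) {X Z : ℤ} {K K' : ℕ}
    (h : ∀ N, P (N + 1) X K Z = (P N (X - 1) K' Z + P N (X + 1) K' Z) / 2) :
    visitGF l K Z X = (if X = 0 ∧ K = 0 then 1 else 0) +
      l / 2 * (visitGF l K' Z (X - 1) + visitGF l K' Z (X + 1)) := by
  have h₁ := summable_pow_mul_P hl0 hl1 (X - 1) K' Z
  have h₂ := summable_pow_mul_P hl0 hl1 (X + 1) K' Z
  unfold visitGF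
  rw [(summable_pow_mul_P hl0 hl1 X K Z).tsum_eq_zero_add, P_zero, ← h₁.tsum_add h₂,
    ← tsum_mul_left, pow_zero, one_mul]
  congr 2
  funext N
  rw [h]
  ring

lemma visitGF_zero_self {l : ℝ} (hl0 : 0 < l) (hl1 : l < 1) {Z : ℤ} (hZ : Z ≠ 0) :
    visitGF l 0 Z Z = 0 := by
  unfold visitGF
  rw [(summable_pow_mul_P hl0 hl1 Z 0 Z).tsum_eq_zero_add, P_zero]
  simp [P_succ_self_zero, hZ]

/-- A bounded function which at each point either vanishes or equals `l` times the mean of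
its neighbouring values is zero, provided `0 < l < 1`. -/
lemma eq_zero_of_bounded_of_mean {l : ℝ} (hl0 : 0 < l) (hl1 : l < 1) {D : ℤ → ℝ} {C : ℝ}
    (hC : ∀ x, |D x| ≤ C) (hD : ∀ x, D x = 0 ∨ D x = l / 2 * (D (x - 1) + D (x + 1))) (x : ℤ) :
    D x = 0 := by
  have hC0 : 0 ≤ C := (abs_nonneg _).trans (hC 0)
  have key : ∀ n : ℕ, ∀ x, |D x| ≤ l ^ n * C := by
    intro n
    induction n with
    | zero => simpa using hC
    | succ n ih =>
      intro x
      rcases hD x with h | h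
      · rw [h, abs_zero]
        positivity
      · rw [h, abs_mul, abs_of_pos (half_pos hl0)]
        calc l / 2 * |D (x - 1) + D (x + 1)|
            ≤ l / 2 * (l ^ n * C + l ^ n * C) := by
              gcongr
              exact (abs_add_le _ _).trans (add_le_add (ih _) (ih _))
          _ = l ^ (n + 1) * C := by ring
  have hlim : Tendsto (fun n : ℕ => l ^ n * C) atTop (nhds 0) := by
    simpa using (tendsto_pow_atTop_nhds_zero_of_lt_one hl0.le hl1).mul_const C
  exact abs_nonpos_iff.1 (ge_of_tendsto' hlim fun n => key n x)

lemma mean_pow_natAbs {l α : ℝ} (h : l * (1 + α ^ 2) = 2 * α) {x : ℤ} (hx : x ≠ 0) :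
    l / 2 * (α ^ (x - 1).natAbs + α ^ (x + 1).natAbs) = α ^ x.natAbs := by
  obtain ⟨m, hm⟩ : ∃ m, x.natAbs = m + 1 := ⟨x.natAbs - 1, by omega⟩
  rcases lt_or_gt_of_ne hx with hneg | hpos
  · rw [show (x - 1).natAbs = m + 2 by omega, show (x + 1).natAbs = m by omega, hm]
    linear_combination α ^ m / 2 * h
  · rw [show (x - 1).natAbs = m by omega, show (x + 1).natAbs = m + 2 by omega, hm]
    linear_combination α ^ m / 2 * h

/-- A bounded solution of the mean-value recurrence with source `s` away from `Z`
is determined by its value at `Z`. -/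
lemma eq_of_bounded_of_mean {l : ℝ} (hl0 : 0 < l) (hl1 : l < 1) {Z : ℤ} {F G s : ℤ → ℝ} {A B : ℝ}
    (hFb : ∀ x, |F x| ≤ A) (hGb : ∀ x, |G x| ≤ B)
    (hF : ∀ x, x ≠ Z → F x = s x + l / 2 * (F (x - 1) + F (x + 1)))
    (hG : ∀ x, x ≠ Z → G x = s x + l / 2 * (G (x - 1) + G (x + 1)))
    (hZ : F Z = G Z) (x : ℤ) : F x = G x := by
  refine sub_eq_zero.1 (eq_zero_of_bounded_of_mean hl0 hl1 (D := fun x => F x - G x) (C := A + B)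
    (fun x => (abs_sub _ _).trans (add_le_add (hFb x) (hGb x))) (fun x => ?_) x)
  by_cases hx : x = Z
  · left
    rw [hx, hZ, sub_self]
  · right
    rw [hF x hx, hG x hx]
    ring

lemma abs_pow_le_one_of_pos_of_lt_one {α : ℝ} (h0 : 0 < α) (h1 : α < 1) (n : ℕ) : |α ^ n| ≤ 1 := by
  rw [abs_of_pos (by positivity)]
  exact pow_le_one₀ h0.le h1.le

lemma visitGF_zero {l α : ℝ} (hl0 : 0 < l) (hl1 : l < 1) (h0 : 0 < α) (h1 : α < 1)
    (h : l * (1 + α ^ 2) = 2 * α) {Z : ℤ} (hZ : 1 ≤ Z) (X : ℤ) :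
    visitGF l 0 Z X = (1 + α ^ 2) / (1 - α ^ 2) *
      (α ^ X.natAbs - α ^ Z.natAbs * α ^ (X - Z).natAbs) := by
  have hα : 0 < 1 - α ^ 2 := by nlinarith
  refine eq_of_bounded_of_mean hl0 hl1 (Z := Z)
    (G := fun X => (1 + α ^ 2) / (1 - α ^ 2) *
      (α ^ X.natAbs - α ^ Z.natAbs * α ^ (X - Z).natAbs))
    (s := fun X => if X = 0 then 1 else 0)
    (abs_visitGF_le hl0 hl1 0 Z) (B := (1 + α ^ 2) / (1 - α ^ 2) * (1 + 1 * 1)) (fun x => ?_)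
    (fun x hx => ?_) (fun x hx => ?_) ?_ X
  · rw [abs_mul, abs_of_pos (by positivity)]
    gcongr
    refine (abs_sub _ _).trans ?_
    rw [abs_mul]
    gcongr <;> exact abs_pow_le_one_of_pos_of_lt_one h0 h1 _
  · rw [visitGF_eq_of_succ hl0 hl1 (fun N => P_succ_of_ne hx N 0)]
    simp
  · have hs := mean_pow_natAbs h (sub_ne_zero.2 hx)
    rw [show x - Z - 1 = x - 1 - Z by ring, show x - Z + 1 = x + 1 - Z by ring] at hs
    rw [← hs]
    by_cases hx0 : x = 0
    · subst hx0
      field_simp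
      simp
      linear_combination (-2 * α) * h
    · rw [if_neg hx0]
      linear_combination -((1 + α ^ 2) / (1 - α ^ 2)) * mean_pow_natAbs h hx0
  · rw [visitGF_zero_self hl0 hl1 (by omega)]
    simp

lemma visitGF_eq_mul_self {l α : ℝ} (hl0 : 0 < l) (hl1 : l < 1) (h0 : 0 < α) (h1 : α < 1)
    (h : l * (1 + α ^ 2) = 2 * α) (K : ℕ) (Z X : ℤ) :
    visitGF l (K + 1) Z X = visitGF l (K + 1) Z Z * α ^ (X - Z).natAbs := by
  refine eq_of_bounded_of_mean hl0 hl1 (Z := Z)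
    (G := fun X => visitGF l (K + 1) Z Z * α ^ (X - Z).natAbs) (s := fun _ => 0)
    (abs_visitGF_le hl0 hl1 _ Z) (B := (1 - l)⁻¹ * 1) (fun x => ?_)
    (fun x hx => ?_) (fun x hx => ?_) ?_ X
  · rw [abs_mul]
    exact mul_le_mul (abs_visitGF_le hl0 hl1 _ _ _) (abs_pow_le_one_of_pos_of_lt_one h0 h1 _)
      (abs_nonneg _) (inv_nonneg.2 (by linarith))
  · rw [visitGF_eq_of_succ hl0 hl1 (fun N => P_succ_of_ne hx N (K + 1))]
    simp
  · have hs := mean_pow_natAbs h (sub_ne_zero.2 hx)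
    rw [show x - Z - 1 = x - 1 - Z by ring, show x - Z + 1 = x + 1 - Z by ring] at hs
    rw [← hs]
    ring
  · simp

lemma visitGF_succ_self {l α : ℝ} (hl0 : 0 < l) (hl1 : l < 1) (h0 : 0 < α) (h1 : α < 1)
    (h : l * (1 + α ^ 2) = 2 * α) {Z : ℤ} (hZ : 1 ≤ Z) (K : ℕ) :
    visitGF l (K + 1) Z Z = (2 * α ^ 2 / (1 + α ^ 2)) ^ K * α ^ Z.natAbs := by
  have hα : 0 < 1 - α ^ 2 := by nlinarith
  have hl : l = 2 * α / (1 + α ^ 2) := by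
    rw [eq_div_iff (by positivity), h]
  induction K with
  | zero =>
    rw [visitGF_eq_of_succ hl0 hl1 (fun N => P_succ_self_succ Z N 0),
      visitGF_zero hl0 hl1 h0 h1 h hZ, visitGF_zero hl0 hl1 h0 h1 h hZ]
    obtain ⟨m, hm⟩ : ∃ m, Z.natAbs = m + 1 := ⟨Z.natAbs - 1, by omega⟩
    rw [show (Z - 1).natAbs = m by omega, show (Z + 1).natAbs = m + 2 by omega,
      show (Z - 1 - Z).natAbs = 1 by omega, show (Z + 1 - Z).natAbs = 1 by omega, hm, hl]
    simp
    field_simp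
    ring
  | succ K ih =>
    rw [visitGF_eq_of_succ hl0 hl1 (fun N => P_succ_self_succ Z N (K + 1)),
      visitGF_eq_mul_self hl0 hl1 h0 h1 h K Z (Z - 1),
      visitGF_eq_mul_self hl0 hl1 h0 h1 h K Z (Z + 1), ih,
      show (Z - 1 - Z).natAbs = 1 by omega, show (Z + 1 - Z).natAbs = 1 by omega, hl]
    simp
    ring

/-- Eq. (3.14), `K ≥ 1` case: the fixed-visit-number generating function. -/
theorem fixed_visit_generating_function (l : ℝ) (hl0 : 0 < l) (hl1 : l < 1)
    (Z X : ℤ) (hZ : 1 ≤ Z) (K : ℕ) (hK : 1 ≤ K)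
    (α : ℝ) (hα : α = (1 - Real.sqrt (1 - l ^ 2)) / l) :
    HasSum (fun N : ℕ => l ^ N * P N X K Z)
      ((2 * α ^ 2 / (1 + α ^ 2)) ^ (K - 1) * α ^ (Z + |X - Z|).toNat) := by
  have hr : 0 < 1 - l ^ 2 := by nlinarith
  have hs0 : 0 < √(1 - l ^ 2) := Real.sqrt_pos.2 hr
  have hs : √(1 - l ^ 2) ^ 2 = 1 - l ^ 2 := Real.sq_sqrt hr.le
  have hαl : α * l = 1 - √(1 - l ^ 2) := by rw [hα, div_mul_cancel₀ _ hl0.ne']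
  have h0 : 0 < α := by
    rw [hα]
    exact div_pos (by nlinarith) hl0
  have h : l * (1 + α ^ 2) = 2 * α := by
    rw [hα]
    field_simp
    linear_combination hs
  have h1 : α < 1 := by
    nlinarith
  have hsum := (summable_pow_mul_P hl0 hl1 X K Z).hasSum
  obtain ⟨K, rfl⟩ : ∃ k, K = k + 1 := ⟨K - 1, by omega⟩
  change HasSum _ (visitGF l (K + 1) Z X) at hsum
  rw [visitGF_eq_mul_self hl0 hl1 h0 h1 h, visitGF_succ_self hl0 hl1 h0 h1 h hZ, mul_assoc,
    ← pow_add] at hsum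
  rwa [Nat.add_sub_cancel, show (Z + |X - Z|).toNat = Z.natAbs + (X - Z).natAbs by
    rw [Int.abs_eq_natAbs]; omega]
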